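/- (Morera-type theorem for λ-slice monogenic functions.) Let λ ∈ ℝ, let U ⊆ ℝ^{n+1} be an axially symmetric s-domain and let ℓ : U → ℝ_n be continuous. Suppose that for every I ∈ 𝕊 and every closed piecewise-C¹ curve γ : [0,1] → U_I that is homotopic to a constant curve within U_I one has ∫_0^1 e^{λ Re γ(t)} γ′(t) (−I) ℓ(γ(t)) dt = 0. Then for every I ∈ 𝕊 the restriction ℓ_I is real differentiable on U_I and satisfies ∂̄_I ℓ_I(u+Iv) + λ ℓ_I(u+Iv) = 0 for all u + Iv ∈ U_I. -/

import Mathlib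

open scoped BigOperators
open Set

noncomputable section

/-- The sphere 𝕊 of (coefficient vectors of) unit 1-vectors in ℝⁿ. -/
def USphere (n : ℕ) : Set (Fin n → ℝ) := {x | ∑ i, x i ^ 2 = 1}

/-- Points of ℝ^{n+1}, written as (x₀, (x₁, …, xₙ)). -/
abbrev Pt (n : ℕ) := ℝ × (Fin n → ℝ)

variable {n : ℕ} {Cl : Type} [NormedRing Cl] [NormedAlgebra ℝ Cl]

/-- The 1-vector of the Clifford algebra with coefficients `x` w.r.t. generators `e`. -/
def vecEmb (e : Fin n → Cl) (x : Fin n → ℝ) : Cl := ∑ i, x i • e i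

/-- The defining relations `eᵢeⱼ + eⱼeᵢ = -2δᵢⱼ` of the Clifford algebra ℝₙ. -/
def CliffordRel (e : Fin n → Cl) : Prop :=
  ∀ i j, e i * e j + e j * e i = if i = j then (-2 : Cl) else 0

/-- The slice Cauchy–Riemann operator `(∂/∂u + I ∂/∂v)` applied to the restriction of `f`
to the slice `ℂ_I`, `I = vecEmb e x`, evaluated at the point `u + I v`. -/
def sliceCR (e : Fin n → Cl) (f : Pt n → Cl) (x : Fin n → ℝ) (u v : ℝ) : Cl :=
  deriv (fun t => f (t, v • x)) u + vecEmb e x * deriv (fun t => f (u, t • x)) v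

/-- λ-slice monogenic functions on `U`. -/
def SMlam (e : Fin n → Cl) (lam : ℝ) (U : Set (Pt n)) (f : Pt n → Cl) : Prop :=
  ContDiffOn ℝ 1 f U ∧
  ∀ x ∈ USphere n, ∀ u v : ℝ, ((u, v • x) : Pt n) ∈ U →
    sliceCR e f x u v + lam • f (u, v • x) = 0

/-- The coordinates (u,v) of the slice `U_I = U ∩ ℂ_I`, `I = vecEmb e x`. -/
def SlicePre (n : ℕ) (U : Set (Pt n)) (x : Fin n → ℝ) : Set (ℝ × ℝ) :=
  {p | ((p.1, p.2 • x) : Pt n) ∈ U}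

/-- Axially symmetric slice domains in ℝ^{n+1}. -/
def AxSymSDomain (n : ℕ) (U : Set (Pt n)) : Prop :=
  IsOpen U ∧ IsConnected U ∧ (∃ u : ℝ, ((u, (0 : Fin n → ℝ)) : Pt n) ∈ U) ∧
  (∀ x ∈ USphere n, IsConnected (SlicePre n U x)) ∧
  ∀ x ∈ USphere n, ∀ y ∈ USphere n, ∀ u v : ℝ,
    ((u, v • x) : Pt n) ∈ U → ((u, v • y) : Pt n) ∈ U

/-- A holomorphic function with values in `ℂ_I`, `I = vecEmb e x`, on a
(relatively open) coordinate set `V`. -/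
def SliceHolo (e : Fin n → Cl) (x : Fin n → ℝ) (V : Set (ℝ × ℝ)) (F : ℝ × ℝ → Cl) : Prop :=
  DifferentiableOn ℝ F V ∧
  (∀ p ∈ V, ∃ a b : ℝ, F p = algebraMap ℝ Cl a + b • vecEmb e x) ∧
  ∀ p ∈ V, deriv (fun t => F (t, p.2)) p.1 + vecEmb e x * deriv (fun t => F (p.1, t)) p.2 = 0

/-- Ordered product `I_A = I_{i₁} ⋯ I_{i_k}` over a finite index set `A`. -/
def IAprod (e : Fin n → Cl) (J : Fin n → Fin n → ℝ) (A : Finset (Fin n)) : Cl :=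
  ((A.sort (· ≤ ·)).map fun i => vecEmb e (J i)).prod

/-- A closed piecewise-C¹ curve parametrized on [0,1]. -/
def PiecewiseC1 (γ : ℝ → ℝ × ℝ) : Prop :=
  ContinuousOn γ (Icc 0 1) ∧
  ∃ (k : ℕ) (t : Fin (k + 1) → ℝ), t 0 = 0 ∧ t (Fin.last k) = 1 ∧ StrictMono t ∧
    ∀ i : Fin k, ContDiffOn ℝ 1 γ (Icc (t i.castSucc) (t i.succ))

/-- `γ` is a closed curve in `V`, homotopic within `V` to a constant curve. -/
def NullHomotopicIn (γ : ℝ → ℝ × ℝ) (V : Set (ℝ × ℝ)) : Prop :=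
  γ 0 = γ 1 ∧ (∀ t ∈ Icc (0:ℝ) 1, γ t ∈ V) ∧
  ∃ (H : ℝ × ℝ → ℝ × ℝ) (p : ℝ × ℝ),
    ContinuousOn H (Icc 0 1 ×ˢ Icc 0 1) ∧
    (∀ q ∈ (Icc (0:ℝ) 1 ×ˢ Icc (0:ℝ) 1), H q ∈ V) ∧
    (∀ t ∈ Icc (0:ℝ) 1, H (0, t) = γ t) ∧
    (∀ t ∈ Icc (0:ℝ) 1, H (1, t) = p) ∧
    (∀ s ∈ Icc (0:ℝ) 1, H (s, 0) = H (s, 1))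

/-- The inverse `(a + bI)⁻¹` computed in the field `ℂ_I`, `I = vecEmb e x`. -/
def sliceInv (e : Fin n → Cl) (x : Fin n → ℝ) (a b : ℝ) : Cl :=
  (a ^ 2 + b ^ 2)⁻¹ • (algebraMap ℝ Cl a - b • vecEmb e x)

/-- The closed Euclidean ball of ℝ^{n+1}. -/
def EucClosedBall (y : Pt n) (ρ : ℝ) : Set (Pt n) :=
  {p | (p.1 - y.1) ^ 2 + ∑ i, (p.2 i - y.2 i) ^ 2 ≤ ρ ^ 2}

/-- Left fractional integral of order `σ` with respect to `g` (with derivative `g'`),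
with base point `aa`. -/
def fracInt (aa σ : ℝ) (g g' : ℝ → ℝ) (φ : ℝ → Cl) (u : ℝ) : Cl :=
  (Real.Gamma σ)⁻¹ • ∫ τ in aa..u, ((g u - g τ) ^ (σ - 1) * g' τ) • φ τ

/-- Right fractional integral of order `σ` with respect to `h` (with derivative `h'`),
with base point `cc`. -/
def fracIntR (cc σ : ℝ) (h h' : ℝ → ℝ) (φ : ℝ → Cl) (v : ℝ) : Cl :=
  (Real.Gamma σ)⁻¹ • ∫ τ in v..cc, ((h τ - h v) ^ (σ - 1) * h' τ) • φ τ

/-- Left Riemann–Liouville fractional derivative of order `al` w.r.t. `g` on `[aa, bb]`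
(one-sided derivatives at the endpoints). -/
def rlD (aa bb al : ℝ) (g g' : ℝ → ℝ) (φ : ℝ → Cl) (u : ℝ) : Cl :=
  (g' u)⁻¹ • derivWithin (fracInt aa (1 - al) g g' φ) (Icc aa bb) u

/-- The set `S_{a,b,c} ⊆ ℝ^{n+1}`. -/
def Sabc (n : ℕ) (a b c : ℝ) : Set (Pt n) :=
  {p | ∃ x ∈ USphere n, ∃ u ∈ Icc a b, ∃ v ∈ Icc 0 c, p = ((u, v • x) : Pt n)}

/-- Absolutely continuous function on `[a,b]`. -/
def AbsContOn {E : Type} [NormedAddCommGroup E] (φ : ℝ → E) (a b : ℝ) : Prop :=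
  ∀ ε > (0:ℝ), ∃ δ > (0:ℝ), ∀ (k : ℕ) (p q : Fin k → ℝ),
    (∀ i, p i ∈ Icc a b ∧ q i ∈ Icc a b ∧ p i ≤ q i) →
    (∀ i j, i ≠ j → Ioo (p i) (q i) ∩ Ioo (p j) (q j) = ∅) →
    (∑ i, (q i - p i)) < δ → (∑ i, ‖φ (q i) - φ (p i)‖) < ε

/-- The class `AC¹(S_{a,b,c}, ℝₙ)`. -/
def AC1 (a b c r s : ℝ) (f : Pt n → Cl) : Prop :=
  ContinuousOn f (Sabc n a b c) ∧
  ∀ x ∈ USphere n,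
    AbsContOn (fun u => f (u, s • x)) a b ∧ AbsContOn (fun v => f (r, v • x)) 0 c

/-- `A_I(u) = (I_{a+}^{1-α,g}[τ ↦ f(τ + Is)])(u)`, where `I = vecEmb e x`. -/
def AIfun (a al s : ℝ) (g g' : ℝ → ℝ) (f : Pt n → Cl) (x : Fin n → ℝ) : ℝ → Cl :=
  fracInt a (1 - al) g g' fun τ => f (τ, s • x)

/-- `B_I(v) = (I_{0+}^{1-β,h}[τ ↦ f(r + Iτ)])(v)`, where `I = vecEmb e x`. -/
def BIfun (be r : ℝ) (h h' : ℝ → ℝ) (f : Pt n → Cl) (x : Fin n → ℝ) : ℝ → Cl :=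
  fracInt 0 (1 - be) h h' fun τ => f (r, τ • x)

/-- `B_I^{c-}(v) = (I_{c-}^{1-β,h}[τ ↦ f(r + Iτ)])(v)`, where `I = vecEmb e x`. -/
def BIcfun (c be r : ℝ) (h h' : ℝ → ℝ) (f : Pt n → Cl) (x : Fin n → ℝ) : ℝ → Cl :=
  fracIntR c (1 - be) h h' fun τ => f (r, τ • x)

/-- Condition (m1): the maps `A_I` and `B_I` are of class C¹ for every `I ∈ 𝕊`. -/
def M1 (a b c al be r s : ℝ) (g g' h h' : ℝ → ℝ) (f : Pt n → Cl) : Prop :=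
  ∀ x ∈ USphere n,
    ContDiffOn ℝ 1 (AIfun a al s g g' f x) (Icc a b) ∧
    ContDiffOn ℝ 1 (BIfun be r h h' f x) (Icc 0 c)

/-- Riemann–Liouville fractional slice monogenic functions of order `(α,β)`
with respect to `(g,h)` on `S_{a,b,c}`. -/
def RLSM (a b c al be r s : ℝ) (g g' h h' : ℝ → ℝ) (e : Fin n → Cl) (f : Pt n → Cl) : Prop :=
  AC1 a b c r s f ∧ M1 a b c al be r s g g' h h' f ∧
  ∀ x ∈ USphere n, ∀ u ∈ Icc a b, ∀ v ∈ Icc 0 c,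
    (g' u)⁻¹ • derivWithin (AIfun a al s g g' f x) (Icc a b) u +
      vecEmb e x * ((h' v)⁻¹ • derivWithin (BIfun be r h h' f x) (Icc 0 c) v) = 0


open MeasureTheory

/-- The clamp of a real number to `[0, 1]`. -/
def unitClamp (s : ℝ) : ℝ := max 0 (min 1 s)

lemma unitClamp_of_nonpos {s : ℝ} (h : s ≤ 0) : unitClamp s = 0 :=
  max_eq_left ((min_le_right _ _).trans h)

lemma unitClamp_of_one_le {s : ℝ} (h : 1 ≤ s) : unitClamp s = 1 := by
  simp [unitClamp, min_eq_left h]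

lemma unitClamp_of_mem {s : ℝ} (h : s ∈ Icc (0 : ℝ) 1) : unitClamp s = s := by
  simp [unitClamp, min_eq_right h.2, max_eq_right h.1]

/-- The boundary of the rectangle with opposite corners `(a, c)` and `(b, d)`, each side being
traversed at constant speed in a quarter of the unit interval. -/
def rectPath (a b c d t : ℝ) : ℝ × ℝ :=
  (a + (unitClamp (4 * t) - unitClamp (4 * t - 2)) * (b - a),
    c + (unitClamp (4 * t - 1) - unitClamp (4 * t - 3)) * (d - c))

/-- The successive corners of the rectangle with opposite corners `(a, c)` and `(b, d)`,
the first one being repeated at the end. -/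
def rectCorner (a b c d : ℝ) : Fin 5 → ℝ × ℝ := ![(a, c), (b, c), (b, d), (a, d), (a, c)]

lemma rectPath_eq (a b c d : ℝ) (i : Fin 4) {t : ℝ}
    (ht : t ∈ Icc ((i : ℝ) / 4) ((i : ℝ) / 4 + 1 / 4)) :
    rectPath a b c d t = rectCorner a b c d i.castSucc +
      (4 * (t - (i : ℝ) / 4)) • (rectCorner a b c d i.succ - rectCorner a b c d i.castSucc) := by
  obtain ⟨h₁, h₂⟩ := ht
  fin_cases i <;> simp at h₁ h₂ <;>
    simp [rectPath, rectCorner, -mul_eq_mul_left_iff, -mul_eq_mul_right_iff]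
  · rw [unitClamp_of_mem ⟨by linarith, by linarith⟩, unitClamp_of_nonpos (by linarith),
      unitClamp_of_nonpos (by linarith), unitClamp_of_nonpos (by linarith)]
    constructor <;> grind
  · rw [unitClamp_of_one_le (by linarith), unitClamp_of_nonpos (by linarith),
      unitClamp_of_mem ⟨by linarith, by linarith⟩, unitClamp_of_nonpos (by linarith)]
    constructor <;> grind
  · rw [unitClamp_of_one_le (by linarith), unitClamp_of_mem ⟨by linarith, by linarith⟩,
      unitClamp_of_one_le (by linarith), unitClamp_of_nonpos (by linarith)]
    constructor <;> grind
  · rw [unitClamp_of_one_le (by linarith), unitClamp_of_one_le (by linarith),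
      unitClamp_of_one_le (by linarith), unitClamp_of_mem ⟨by linarith, by linarith⟩]
    constructor <;> grind

lemma continuous_rectPath (a b c d : ℝ) : Continuous (rectPath a b c d) := by
  unfold rectPath unitClamp
  fun_prop

lemma piecewiseC1_rectPath (a b c d : ℝ) : PiecewiseC1 (rectPath a b c d) := by
  refine ⟨(continuous_rectPath a b c d).continuousOn, 4, fun i => (i : ℝ) / 4, by simp, by simp,
    fun i j h => ?_, fun i => ?_⟩
  · have : ((i : ℕ) : ℝ) < (j : ℕ) := by exact_mod_cast h
    simp only
    linarith
  · refine ContDiffOn.congr (f := fun t : ℝ => rectCorner a b c d i.castSucc +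
      (4 * (t - (i : ℝ) / 4)) • (rectCorner a b c d i.succ - rectCorner a b c d i.castSucc))
      (by fun_prop) fun t ht => rectPath_eq a b c d i ⟨by simpa using ht.1, ?_⟩
    have := ht.2
    simp only [Fin.val_succ, Nat.cast_add, Nat.cast_one] at this
    linarith

lemma rectPath_mem (a b c d t : ℝ) :
    rectPath a b c d t ∈ uIcc a b ×ˢ uIcc c d := by
  have hm : Monotone unitClamp := fun s t h => max_le_max le_rfl (min_le_min le_rfl h)
  have h0 (s : ℝ) : 0 ≤ unitClamp s := le_max_left _ _
  have h1 (s : ℝ) : unitClamp s ≤ 1 := max_le zero_le_one (min_le_left _ _)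
  have key (x y r : ℝ) (hr₀ : 0 ≤ r) (hr₁ : r ≤ 1) : x + r * (y - x) ∈ uIcc x y :=
    (convex_uIcc x y).add_smul_sub_mem left_mem_uIcc right_mem_uIcc ⟨hr₀, hr₁⟩
  refine ⟨key _ _ _ (sub_nonneg.2 (hm (by linarith))) ?_,
    key _ _ _ (sub_nonneg.2 (hm (by linarith))) ?_⟩
  · linarith [h1 (4 * t), h0 (4 * t - 2)]
  · linarith [h1 (4 * t - 1), h0 (4 * t - 3)]

lemma nullHomotopicIn_of_convex {γ : ℝ → ℝ × ℝ} {R V : Set (ℝ × ℝ)} (hR : Convex ℝ R)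
    (hRV : R ⊆ V) (hγ : ContinuousOn γ (Icc 0 1)) (hγR : ∀ t ∈ Icc (0 : ℝ) 1, γ t ∈ R)
    (hcl : γ 0 = γ 1) : NullHomotopicIn γ V := by
  refine ⟨hcl, fun t ht => hRV (hγR t ht), fun q => γ q.2 + q.1 • (γ 0 - γ q.2), γ 0, ?_,
    fun q hq => hRV (hR.add_smul_sub_mem (hγR _ hq.2) (hγR 0 (by simp)) hq.1), by simp, by simp,
    by simp [hcl]⟩
  have h : ContinuousOn (fun q : ℝ × ℝ => γ q.2) (Icc 0 1 ×ˢ Icc 0 1) :=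
    hγ.comp continuousOn_snd fun q hq => hq.2
  exact h.add (continuousOn_fst.smul (continuousOn_const.sub h))

lemma nullHomotopicIn_rectPath {a b c d : ℝ} {V : Set (ℝ × ℝ)}
    (hV : uIcc a b ×ˢ uIcc c d ⊆ V) : NullHomotopicIn (rectPath a b c d) V :=
  nullHomotopicIn_of_convex ((convex_uIcc a b).prod (convex_uIcc c d)) hV
    (continuous_rectPath a b c d).continuousOn (fun t _ => rectPath_mem a b c d t)
    (by norm_num [rectPath, unitClamp])

/-- The contribution of a line segment, traversed at constant speed in time `1 / 4`,
to a contour integral. -/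
lemma integral_segment {γ : ℝ → ℝ × ℝ} {P Q : ℝ × ℝ} {p : ℝ}
    (hγ : ∀ t ∈ Icc p (p + 1 / 4), γ t = P + (4 * (t - p)) • (Q - P))
    {R : Set (ℝ × ℝ)} (hR : Convex ℝ R) (hP : P ∈ R) (hQ : Q ∈ R)
    {ψ : ℝ × ℝ → Cl} (hψ : ContinuousOn ψ R) (I : Cl) :
    IntervalIntegrable (fun t => ((deriv γ t).1 • (1 : Cl) + (deriv γ t).2 • I) * ψ (γ t))
      volume p (p + 1 / 4) ∧
    ∫ t in p..(p + 1 / 4), ((deriv γ t).1 • (1 : Cl) + (deriv γ t).2 • I) * ψ (γ t) =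
      (Q - P).1 • (∫ s in (0 : ℝ)..1, ψ (P + s • (Q - P))) +
        (Q - P).2 • (∫ s in (0 : ℝ)..1, I * ψ (P + s • (Q - P))) := by
  have hle : p ≤ p + 1 / 4 := by linarith
  set κ : Cl := (Q - P).1 • (1 : Cl) + (Q - P).2 • I with hκ
  set g : ℝ → Cl := fun t => (4 : ℝ) • (κ * ψ (P + (4 * t + -(4 * p)) • (Q - P))) with hg
  have hline : ContinuousOn (fun s : ℝ => ψ (P + s • (Q - P))) (Icc 0 1) :=
    hψ.comp (by fun_prop) fun s hs => hR.add_smul_sub_mem hP hQ hs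
  have heq : EqOn g (fun t => ((deriv γ t).1 • (1 : Cl) + (deriv γ t).2 • I) * ψ (γ t))
      (Ioo p (p + 1 / 4)) := by
    intro t ht
    have hev : γ =ᶠ[nhds t] fun t => P + (4 * (t - p)) • (Q - P) :=
      Filter.eventually_of_mem (Icc_mem_nhds ht.1 ht.2) hγ
    have hd : deriv γ t = (4 : ℝ) • (Q - P) := by
      rw [hev.deriv_eq]
      have h4 : HasDerivAt (fun t : ℝ => 4 * (t - p)) (4 * 1) t :=
        ((hasDerivAt_id t).sub_const p).const_mul 4
      simpa using ((h4.smul_const (Q - P)).const_add P).deriv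
    simp only [hg, hd, hγ t (Ioo_subset_Icc_self ht), hκ, Prod.smul_fst, Prod.smul_snd,
      smul_eq_mul]
    rw [mul_smul, mul_smul, ← smul_add, smul_mul_assoc, show 4 * t + -(4 * p) = 4 * (t - p) by ring]
  have hgc : ContinuousOn g (uIcc p (p + 1 / 4)) := by
    rw [uIcc_of_le hle]
    have : ContinuousOn (fun t : ℝ => ψ (P + (4 * t + -(4 * p)) • (Q - P))) (Icc p (p + 1 / 4)) :=
      hline.comp (f := fun t : ℝ => 4 * t + -(4 * p)) (by fun_prop)
        fun t ht => ⟨by linarith [ht.1], by linarith [ht.2]⟩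
    exact (continuousOn_const.mul this).const_smul (4 : ℝ)
  have hli : IntervalIntegrable (fun s : ℝ => ψ (P + s • (Q - P))) volume 0 1 :=
    ContinuousOn.intervalIntegrable (by simpa using hline)
  have hli' : IntervalIntegrable (fun s : ℝ => I * ψ (P + s • (Q - P))) volume 0 1 :=
    ContinuousOn.intervalIntegrable (by
      rw [uIcc_of_le zero_le_one]; exact continuousOn_const.mul hline)
  refine ⟨hgc.intervalIntegrable.congr_uIoo (by rwa [uIoo_of_le hle]), ?_⟩
  rw [← intervalIntegral.integral_congr_Ioo_of_le hle heq, hg, intervalIntegral.integral_smul,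
    intervalIntegral.smul_integral_comp_mul_add (fun s => κ * ψ (P + s • (Q - P))),
    ← intervalIntegral.integral_smul, ← intervalIntegral.integral_smul]
  refine Eq.trans ?_ (intervalIntegral.integral_add (hli.smul (Q - P).1) (hli'.smul (Q - P).2))
  simp only [hκ, add_mul, smul_mul_assoc, one_mul]
  congr 1 <;> ring

lemma integral_rectPath {a b c d : ℝ} {ψ : ℝ × ℝ → Cl}
    (hψ : ContinuousOn ψ (uIcc a b ×ˢ uIcc c d)) (I : Cl) :
    ∫ t in (0 : ℝ)..1, ((deriv (rectPath a b c d) t).1 • (1 : Cl) +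
        (deriv (rectPath a b c d) t).2 • I) * ψ (rectPath a b c d t) =
      (∫ u in a..b, ψ (u, c)) - (∫ u in a..b, ψ (u, d)) +
        (∫ v in c..d, I * ψ (b, v)) - ∫ v in c..d, I * ψ (a, v) := by
  have hmem (j : Fin 5) : rectCorner a b c d j ∈ uIcc a b ×ˢ uIcc c d := by
    fin_cases j <;> simp [rectCorner, -uIcc_prod_uIcc]
  have H (i : Fin 4) := integral_segment (fun t ht => rectPath_eq a b c d i ht)
    ((convex_uIcc a b).prod (convex_uIcc c d)) (hmem i.castSucc) (hmem i.succ) hψ I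
  set F : ℝ → Cl := fun t => ((deriv (rectPath a b c d) t).1 • (1 : Cl) +
        (deriv (rectPath a b c d) t).2 • I) * ψ (rectPath a b c d t) with hF
  have sub (f : ℝ → Cl) (x y : ℝ) :
      (y - x) • ∫ s in (0 : ℝ)..1, f (x + s * (y - x)) = ∫ s in x..y, f s := by
    simpa [mul_comm, add_comm] using
      intervalIntegral.smul_integral_comp_mul_add (a := 0) (b := 1) f (y - x) x
  obtain ⟨i₀, e₀⟩ : IntervalIntegrable F volume 0 (1 / 4) ∧
      ∫ t in 0..(1 / 4), F t = ∫ u in a..b, ψ (u, c) := by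
    simpa [rectCorner, sub fun u => ψ (u, c)] using H 0
  obtain ⟨i₁, e₁⟩ : IntervalIntegrable F volume (1 / 4) (1 / 4 + 1 / 4) ∧
      ∫ t in (1 / 4)..(1 / 4 + 1 / 4), F t = ∫ v in c..d, I * ψ (b, v) := by
    simpa [rectCorner, sub fun v => I * ψ (b, v)] using H 1
  obtain ⟨i₂, e₂⟩ : IntervalIntegrable F volume (2 / 4) (2 / 4 + 1 / 4) ∧
      ∫ t in (2 / 4)..(2 / 4 + 1 / 4), F t = ∫ u in b..a, ψ (u, d) := by
    simpa [rectCorner, sub fun u => ψ (u, d)] using H 2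
  obtain ⟨i₃, e₃⟩ : IntervalIntegrable F volume (3 / 4) (3 / 4 + 1 / 4) ∧
      ∫ t in (3 / 4)..(3 / 4 + 1 / 4), F t = ∫ v in d..c, I * ψ (a, v) := by
    simpa [rectCorner, sub fun v => I * ψ (a, v)] using H 3
  rw [show (1 / 4 + 1 / 4 : ℝ) = 2 / 4 by norm_num] at i₁ e₁
  rw [show (2 / 4 + 1 / 4 : ℝ) = 3 / 4 by norm_num] at i₂ e₂
  rw [show (3 / 4 + 1 / 4 : ℝ) = 1 by norm_num] at i₃ e₃
  rw [← intervalIntegral.integral_add_adjacent_intervals ((i₀.trans i₁).trans i₂) i₃,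
    ← intervalIntegral.integral_add_adjacent_intervals (i₀.trans i₁) i₂,
    ← intervalIntegral.integral_add_adjacent_intervals i₀ i₁, e₀, e₁, e₂, e₃,
    intervalIntegral.integral_symm a b, intervalIntegral.integral_symm c d]
  abel

lemma vecEmb_mul_self {e : Fin n → Cl} (he : CliffordRel e) {x : Fin n → ℝ}
    (hx : x ∈ USphere n) : vecEmb e x * vecEmb e x = -1 := by
  have h : vecEmb e x * vecEmb e x = ∑ i, ∑ j, (x i * x j) • (e i * e j) := by
    simp [vecEmb, Finset.sum_mul_sum, smul_smul, mul_comm]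
  have h' : vecEmb e x * vecEmb e x = ∑ i, ∑ j, (x i * x j) • (e j * e i) := by
    rw [h, Finset.sum_comm]
    simp only [mul_comm]
  have key : (2 : ℝ) • (vecEmb e x * vecEmb e x) = (2 : ℝ) • (-1 : Cl) := by
    calc (2 : ℝ) • (vecEmb e x * vecEmb e x)
        = vecEmb e x * vecEmb e x + vecEmb e x * vecEmb e x := two_smul _ _
      _ = ∑ i, ∑ j, (x i * x j) • (e i * e j + e j * e i) := by
        conv_lhs => rw [h]
        conv_lhs => enter [2]; rw [← h, h']
        simp only [smul_add, Finset.sum_add_distrib]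
      _ = ∑ i, (x i ^ 2) • (-2 : Cl) := by
        simp only [he _ _, smul_ite, smul_zero, Finset.sum_ite_eq, Finset.mem_univ, if_true, sq]
      _ = (2 : ℝ) • (-1 : Cl) := by
        rw [← Finset.sum_smul, show ∑ i, x i ^ 2 = 1 from hx, one_smul, two_smul]
        norm_num
  exact smul_right_injective Cl two_ne_zero key

/-- The space of real linear maps `ℂ → Cl`, as a complex Banach space on which `ℂ` acts through
the domain. -/
def ComplexHom (Cl : Type) [NormedRing Cl] [NormedAlgebra ℝ Cl] : Type := ℂ →L[ℝ] Cl

instance : NormedAddCommGroup (ComplexHom Cl) := inferInstanceAs (NormedAddCommGroup (ℂ →L[ℝ] Cl))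

instance [CompleteSpace Cl] : CompleteSpace (ComplexHom Cl) :=
  inferInstanceAs (CompleteSpace (ℂ →L[ℝ] Cl))

instance : NormedSpace ℂ (ComplexHom Cl) where
  smul z T := ContinuousLinearMap.comp (M₂ := ℂ) (show ℂ →L[ℝ] Cl from T)
    (ContinuousLinearMap.mul ℝ ℂ z)
  one_smul T := ContinuousLinearMap.ext fun w => congrArg (show ℂ →L[ℝ] Cl from T) (one_mul w)
  mul_smul z z' T := ContinuousLinearMap.ext fun w =>
    congrArg (show ℂ →L[ℝ] Cl from T) (by simp; ring)
  smul_zero z := rfl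
  smul_add z T T' := rfl
  add_smul z z' T := ContinuousLinearMap.ext fun w =>
    (congrArg (show ℂ →L[ℝ] Cl from T) (add_mul z z' w)).trans (map_add _ _ _)
  zero_smul T := ContinuousLinearMap.ext fun w =>
    (congrArg (show ℂ →L[ℝ] Cl from T) (zero_mul w)).trans (map_zero _)
  norm_smul_le z T := by
    refine (ContinuousLinearMap.opNorm_comp_le (show ℂ →L[ℝ] Cl from T) _).trans ?_
    rw [mul_comm]
    exact mul_le_mul_of_nonneg_right (ContinuousLinearMap.opNorm_mul_apply_le ℝ ℂ z)
      (norm_nonneg _)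

namespace ComplexHom

/-- Evaluation of a real linear map `ℂ → Cl` at a complex number. -/
def eval (w : ℂ) : ComplexHom Cl →L[ℝ] Cl where
  toFun T := (show ℂ →L[ℝ] Cl from T) w
  map_add' _ _ := rfl
  map_smul' r T := by
    change (show ℂ →L[ℝ] Cl from T) ((r : ℂ) * w) = r • (show ℂ →L[ℝ] Cl from T) w
    rw [← map_smul, Complex.real_smul]
  cont := (ContinuousLinearMap.apply ℝ Cl w).continuous

lemma eval_smul (w z : ℂ) (T : ComplexHom Cl) : eval w (z • T) = eval (z * w) T := rfl

lemma ext {T T' : ComplexHom Cl} (h : ∀ w, eval w T = eval w T') : T = T' :=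
  ContinuousLinearMap.ext h

/-- The real linear map `ℂ → Cl` which sends `u + iv` to `u + vI`. -/
def slice (I : Cl) : ℂ →L[ℝ] Cl := Complex.reCLM.smulRight 1 + Complex.imCLM.smulRight I

lemma slice_apply (I : Cl) (w : ℂ) : slice I w = w.re • 1 + w.im • I := rfl

/-- The embedding of `Cl` into `ComplexHom Cl` which sends `a` to `u + iv ↦ (u + vI) a`. -/
def embed (I : Cl) : Cl →L[ℝ] ComplexHom Cl where
  toFun a := ((ContinuousLinearMap.mul ℝ Cl).flip a).comp (slice I)
  map_add' a b := ext fun w => mul_add (slice I w) a b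
  map_smul' r a := ext fun w => by
    exact (mul_smul_comm r (slice I w) a).trans (map_smul (eval w) r
      (show ComplexHom Cl from ((ContinuousLinearMap.mul ℝ Cl).flip a).comp (slice I))).symm
  cont := ((ContinuousLinearMap.compL ℝ ℂ Cl Cl).flip (slice I) ∘L
    (ContinuousLinearMap.mul ℝ Cl).flip).continuous

lemma eval_embed (I : Cl) (w : ℂ) (a : Cl) : eval w (embed I a) = (w.re • 1 + w.im • I) * a := rfl

lemma I_smul_embed {I : Cl} (hI : I * I = -1) (a : Cl) :
    Complex.I • embed I a = embed I (I * a) := ext fun w => by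
  rw [eval_smul, eval_embed, eval_embed]
  simp [add_mul, ← mul_assoc, hI]
  abel

end ComplexHom

/-- **Morera's theorem** for functions of two real variables with values in an algebra that
contains a square root `I` of `-1`. -/
lemma hasFDerivAt_of_integral_rect_eq_zero [CompleteSpace Cl] {I : Cl} (hI : I * I = -1)
    {V : Set (ℝ × ℝ)} (hV : IsOpen V) {ψ : ℝ × ℝ → Cl} (hψ : ContinuousOn ψ V)
    (hrect : ∀ a b c d : ℝ, uIcc a b ×ˢ uIcc c d ⊆ V →
      (∫ u in a..b, ψ (u, c)) - (∫ u in a..b, ψ (u, d)) +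
        (∫ v in c..d, I * ψ (b, v)) - (∫ v in c..d, I * ψ (a, v)) = 0) {p : ℝ × ℝ} (hp : p ∈ V) :
    ∃ L : ℝ × ℝ →L[ℝ] Cl, HasFDerivAt ψ L p ∧ L (1, 0) + I * L (0, 1) = 0 := by
  set E := Complex.equivRealProdCLM with hE
  set G : ℂ → ComplexHom Cl := fun z => ComplexHom.embed I (ψ (E z)) with hG
  have hVo : IsOpen (E ⁻¹' V) := hV.preimage E.continuous
  have hGc : ContinuousOn G (E ⁻¹' V) :=
    (ComplexHom.embed I).continuous.comp_continuousOn
      (hψ.comp E.continuous.continuousOn (mapsTo_preimage _ _))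
  have hGcons : Complex.IsConservativeOn G (E ⁻¹' V) := by
    intro z w hzw
    have hsub : uIcc z.re w.re ×ˢ uIcc z.im w.im ⊆ V := fun q hq => by
      simpa using hzw (show E.symm q ∈ Complex.Rectangle z w from hq)
    have hh {v : ℝ} (hv : v ∈ uIcc z.im w.im) :
        IntervalIntegrable (fun u => ψ (u, v)) volume z.re w.re :=
      (hψ.comp (by fun_prop) fun u hu => hsub ⟨hu, hv⟩).intervalIntegrable
    have hv {u : ℝ} (hu : u ∈ uIcc z.re w.re) :
        IntervalIntegrable (fun v => ψ (u, v)) volume z.im w.im :=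
      (hψ.comp (by fun_prop) fun v hv => hsub ⟨hu, hv⟩).intervalIntegrable
    have hmul {u : ℝ} (hu : u ∈ uIcc z.re w.re) :
        ∫ v in z.im..w.im, I * ψ (u, v) = I * ∫ v in z.im..w.im, ψ (u, v) :=
      (ContinuousLinearMap.mul ℝ Cl I).intervalIntegral_comp_comm (hv hu)
    have h0 := hrect _ _ _ _ hsub
    rw [hmul left_mem_uIcc, hmul right_mem_uIcc] at h0
    rw [← add_eq_zero_iff_eq_neg, Complex.wedgeIntegral_add_wedgeIntegral_eq]
    simp only [hG, hE, Complex.equivRealProdCLM_apply, Complex.add_re, Complex.add_im,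
      Complex.ofReal_re, Complex.ofReal_im, Complex.re_ofReal_mul, Complex.im_ofReal_mul,
      Complex.I_re, Complex.I_im, mul_zero, mul_one, add_zero, zero_add]
    rw [(ComplexHom.embed I).intervalIntegral_comp_comm (hh left_mem_uIcc),
      (ComplexHom.embed I).intervalIntegral_comp_comm (hh right_mem_uIcc),
      (ComplexHom.embed I).intervalIntegral_comp_comm (hv left_mem_uIcc),
      (ComplexHom.embed I).intervalIntegral_comp_comm (hv right_mem_uIcc),
      ComplexHom.I_smul_embed hI, ComplexHom.I_smul_embed hI, ← map_sub, ← map_add, ← map_sub,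
      h0, map_zero]
  have hGd : HasDerivAt G (deriv G (E.symm p)) (E.symm p) :=
    (((Complex.isConservativeOn_and_continuousOn_iff_isDifferentiableOn hVo).1 ⟨hGcons, hGc⟩
      ).differentiableAt (hVo.mem_nhds (by simpa using hp))).hasDerivAt
  set g := deriv G (E.symm p)
  have key (w : ℂ) : HasFDerivAt (fun q => (w.re • 1 + w.im • I) * ψ q)
      (ComplexHom.eval w ∘L
        ((ContinuousLinearMap.toSpanSingleton ℂ g).restrictScalars ℝ ∘L
          (E.symm : ℝ × ℝ →L[ℝ] ℂ))) p := by
    have := (ComplexHom.eval w).hasFDerivAt.comp p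
      ((hGd.hasFDerivAt.restrictScalars ℝ).comp p E.symm.hasFDerivAt)
    refine this.congr_of_eventuallyEq (Filter.Eventually.of_forall fun q => ?_)
    simp [hG, ComplexHom.eval_embed]
  have h1 := key 1
  simp only [Complex.one_re, Complex.one_im, one_smul, zero_smul, add_zero, one_mul] at h1
  refine ⟨_, h1, ?_⟩
  have h2 := key Complex.I
  simp only [Complex.I_re, Complex.I_im, one_smul, zero_smul, zero_add] at h2
  have h3 := congrArg (fun L => L (0, 1))
    (((ContinuousLinearMap.mul ℝ Cl I).hasFDerivAt.comp p h1).unique h2)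
  have hE10 : E.symm (1, 0) = 1 := by simp [hE, Complex.ext_iff]
  have hE01 : E.symm (0, 1) = Complex.I := by simp [hE, Complex.ext_iff]
  simp only [ContinuousLinearMap.comp_apply, ContinuousLinearMap.mul_apply',
    ContinuousLinearMap.coe_restrictScalars', ContinuousLinearMap.toSpanSingleton_apply,
    ContinuousLinearEquiv.coe_coe, ComplexHom.eval_smul, hE10, hE01, mul_one,
    Complex.I_mul_I] at h3 ⊢
  rw [h3, ← mul_one (-1 : ℂ), ← ComplexHom.eval_smul, neg_one_smul, map_neg, add_neg_cancel]

/-- Morera-type theorem for λ-slice monogenic functions. -/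
theorem statement7 [CompleteSpace Cl] (e : Fin n → Cl) (he : CliffordRel e) (lam : ℝ)
    (U : Set (Pt n)) (hU : AxSymSDomain n U) (ℓ : Pt n → Cl)
    (hc : ContinuousOn ℓ U)
    (hint : ∀ x ∈ USphere n, ∀ γ : ℝ → ℝ × ℝ, PiecewiseC1 γ →
      NullHomotopicIn γ (SlicePre n U x) →
      ∫ t in (0:ℝ)..1,
        Real.exp (lam * (γ t).1) •
          (((deriv γ t).1 • (1 : Cl) + (deriv γ t).2 • vecEmb e x) *
            (-(vecEmb e x)) * ℓ ((γ t).1, (γ t).2 • x)) = 0) :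
    ∀ x ∈ USphere n,
      DifferentiableOn ℝ (fun p : ℝ × ℝ => ℓ (p.1, p.2 • x)) (SlicePre n U x) ∧
      ∀ p ∈ SlicePre n U x,
        sliceCR e ℓ x p.1 p.2 + lam • ℓ (p.1, p.2 • x) = 0 := by
  intro x hx
  have hI := vecEmb_mul_self he hx
  have hint := hint x hx
  unfold sliceCR
  set I := vecEmb e x
  have hsl : Continuous fun p : ℝ × ℝ => ((p.1, p.2 • x) : Pt n) := by fun_prop
  have hV : IsOpen (SlicePre n U x) := hU.1.preimage hsl
  set ψ : ℝ × ℝ → Cl := fun p => Real.exp (lam * p.1) • (-I * ℓ (p.1, p.2 • x)) with hψ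
  have hℓc : ContinuousOn (fun p : ℝ × ℝ => ℓ (p.1, p.2 • x)) (SlicePre n U x) :=
    hc.comp hsl.continuousOn fun p hp => hp
  have hψc : ContinuousOn ψ (SlicePre n U x) :=
    ContinuousOn.smul (by fun_prop) (continuousOn_const.mul hℓc)
  have hℓ (p : ℝ × ℝ) : ℓ (p.1, p.2 • x) = Real.exp (-lam * p.1) • (I * ψ p) := by
    rw [hψ, mul_smul_comm, smul_smul, ← Real.exp_add, ← mul_assoc, mul_neg, hI]
    simp
  have hrect (a b c d : ℝ) (h : uIcc a b ×ˢ uIcc c d ⊆ SlicePre n U x) :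
      (∫ u in a..b, ψ (u, c)) - (∫ u in a..b, ψ (u, d)) +
        (∫ v in c..d, I * ψ (b, v)) - (∫ v in c..d, I * ψ (a, v)) = 0 := by
    rw [← integral_rectPath (hψc.mono h) I,
      ← hint _ (piecewiseC1_rectPath a b c d) (nullHomotopicIn_rectPath h)]
    simp only [hψ, mul_smul_comm, mul_assoc]
  have hd {p : ℝ × ℝ} (hp : p ∈ SlicePre n U x) : ∃ M : ℝ × ℝ →L[ℝ] Cl,
      HasFDerivAt (fun p : ℝ × ℝ => ℓ (p.1, p.2 • x)) M p ∧
        M (1, 0) + I * M (0, 1) + lam • ℓ (p.1, p.2 • x) = 0 := by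
    obtain ⟨L, hL, hCR⟩ := hasFDerivAt_of_integral_rect_eq_zero hI hV hψc hrect hp
    have h1 : HasFDerivAt (fun q : ℝ × ℝ => Real.exp (-lam * q.1)) _ p :=
      (hasFDerivAt_fst.const_mul (-lam)).exp
    have h2 := h1.smul ((ContinuousLinearMap.mul ℝ Cl I).hasFDerivAt.comp p hL)
    refine ⟨_, h2.congr_of_eventuallyEq (Filter.Eventually.of_forall hℓ), ?_⟩
    have h0 := congrArg (fun a => Real.exp (-lam * p.1) • (I * a)) hCR
    simp only [mul_add, smul_add, mul_zero, smul_zero] at h0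
    rw [hℓ, ← h0]
    simp [mul_smul, smul_comm lam]
    abel
  refine ⟨fun p hp => ?_, fun p hp => ?_⟩
  · obtain ⟨M, hM, -⟩ := hd hp
    exact hM.differentiableAt.differentiableWithinAt
  · obtain ⟨M, hM, hCR⟩ := hd hp
    have hu : HasDerivAt (fun t => ℓ (t, p.2 • x)) (M (1, 0)) p.1 :=
      hM.comp_hasDerivAt (f := fun t => (t, p.2)) p.1
        ((hasDerivAt_id p.1).prodMk (hasDerivAt_const p.1 p.2))
    have hv : HasDerivAt (fun t => ℓ (p.1, t • x)) (M (0, 1)) p.2 :=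
      hM.comp_hasDerivAt (f := fun t => (p.1, t)) p.2
        ((hasDerivAt_const p.2 p.1).prodMk (hasDerivAt_id p.2))
    rw [hu.deriv, hv.deriv, hCR]
end
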